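/- arXiv:1811.10567 — 4 statements merged into one kernel-verified Lean document; each statement's English description precedes it below -/
import Mathlib

section
/- Let H be a finite simple graph whose vertex set is covered by subsets A₁, …, A_m (so V(H) = A₁ ∪ ⋯ ∪ A_m), and let d, l be natural numbers. Suppose that: (i) for every vertex v of H, the number of edges between v and the set ⋃{A_i : v ∉ A_i} is at most d; and (ii) for every i, the induced subgraph of H on A_i is l-list-colorable. Then χ(H) ≤ l + d. -/
/-- A graph `H` is `l`-list-colorable if for every assignment of finite color lists `L v`
with `|L v| ≥ l` to the vertices of `H` there is a proper coloring of `H` choosing each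
vertex's color from its list. -/
def ListColorable {V : Type} (H : SimpleGraph V) (l : ℕ) : Prop :=
  ∀ (α : Type) (L : V → Finset α), (∀ v, l ≤ (L v).card) →
    ∃ c : V → α, (∀ v, c v ∈ L v) ∧ ∀ v w, H.Adj v w → c v ≠ c w

open Classical in
/-- A proper coloring of `H` on `B` extends to `B ∪ S` when `H` induces an `l`-list-colorable graph
on `S` and every vertex of `S \ B` has at most `d` neighbors in `B`. -/
theorem exists_coloring_union {V : Type} [Finite V] {H : SimpleGraph V} {d l : ℕ} {B S : Set V}
    (hS : ListColorable (SimpleGraph.induce S H) l)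
    (hd : ∀ v ∈ S, v ∉ B → {w : V | H.Adj v w ∧ w ∈ B}.ncard ≤ d)
    (hB : ∃ c : V → ℕ, (∀ v ∈ B, c v < l + d) ∧ ∀ v ∈ B, ∀ w ∈ B, H.Adj v w → c v ≠ c w) :
    ∃ c : V → ℕ, (∀ v ∈ B ∪ S, c v < l + d) ∧
      ∀ v ∈ B ∪ S, ∀ w ∈ B ∪ S, H.Adj v w → c v ≠ c w := by
  obtain ⟨c, hlt, hc⟩ := hB
  let N : V → Set V := fun v => {w | H.Adj v w ∧ w ∈ B}
  let L : S → Finset ℕ := fun v =>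
    if (v : V) ∈ B then Finset.range (l + d)
    else Finset.range (l + d) \ (Set.toFinite (N v)).toFinset.image c
  have hL : ∀ v, l ≤ (L v).card := by
    intro v
    by_cases hv : (v : V) ∈ B
    · simp [L, hv]
    · have h₁ := hd v v.2 hv
      rw [Set.ncard_eq_toFinset_card _ (Set.toFinite _)] at h₁
      have h₂ := (Finset.card_image_le (s := (Set.toFinite (N v)).toFinset) (f := c)).trans h₁
      have h₃ := Finset.le_card_sdiff ((Set.toFinite (N v)).toFinset.image c)
        (Finset.range (l + d))
      rw [Finset.card_range] at h₃
      simp only [L, hv, if_false]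
      omega
  obtain ⟨e, he, hadj⟩ := hS ℕ L hL
  have he_lt : ∀ v, e v < l + d := by
    intro v
    have h := he v
    by_cases hv : (v : V) ∈ B
    · simpa [L, hv] using h
    · simp only [L, hv, if_false, Finset.mem_sdiff, Finset.mem_range] at h
      exact h.1
  have he_ne : ∀ v : S, (v : V) ∉ B → ∀ w ∈ B, H.Adj v w → e v ≠ c w := by
    intro v hv w hw hvw heq
    have h := he v
    simp only [L, hv, if_false, Finset.mem_sdiff, Finset.mem_image, Set.Finite.mem_toFinset] at h
    exact h.2 ⟨w, ⟨hvw, hw⟩, heq.symm⟩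
  let f : V → ℕ := fun v => if v ∈ B then c v else if hv : v ∈ S then e ⟨v, hv⟩ else 0
  have hf_mem : ∀ v ∈ B, f v = c v := fun v hv => by simp [f, hv]
  have hf_not_mem : ∀ v (hv : v ∈ S), v ∉ B → f v = e ⟨v, hv⟩ := fun v hv hvB => by
    simp [f, hv, hvB]
  refine ⟨f, fun v hv => ?_, fun v hv w hw hvw => ?_⟩
  · by_cases hvB : v ∈ B
    · rw [hf_mem v hvB]
      exact hlt v hvB
    · rw [hf_not_mem v (hv.resolve_left hvB) hvB]
      exact he_lt _
  · by_cases hvB : v ∈ B <;> by_cases hwB : w ∈ B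
    · rw [hf_mem v hvB, hf_mem w hwB]
      exact hc v hvB w hwB hvw
    · rw [hf_mem v hvB, hf_not_mem w (hw.resolve_left hwB) hwB]
      exact (he_ne _ hwB v hvB hvw.symm).symm
    · rw [hf_mem w hwB, hf_not_mem v (hv.resolve_left hvB) hvB]
      exact he_ne _ hvB w hwB hvw
    · rw [hf_not_mem v (hv.resolve_left hvB) hvB, hf_not_mem w (hw.resolve_left hwB) hwB]
      exact hadj _ _ hvw

/-- Let `H` be a finite graph whose vertex set is covered by subsets `A₁, …, A_m`.
Suppose that for every vertex `v` the number of edges between `v` and `⋃ {Aᵢ : v ∉ Aᵢ}`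
is at most `d`, and that each induced subgraph `H|_{Aᵢ}` is `l`-list-colorable.
Then `χ(H) ≤ l + d`. -/
theorem stmt6 {V : Type} [Fintype V] (H : SimpleGraph V) (m d l : ℕ)
    (A : Fin m → Set V) (hcover : ∀ v, ∃ i, v ∈ A i)
    (hd : ∀ v : V, ({w : V | H.Adj v w ∧ ∃ i, v ∉ A i ∧ w ∈ A i}).ncard ≤ d)
    (hl : ∀ i, ListColorable (SimpleGraph.induce (A i) H) l) :
    H.Colorable (l + d) := by
  have key : ∀ k ≤ m, ∃ c : V → ℕ, (∀ v ∈ {v | ∃ i : Fin m, i < k ∧ v ∈ A i}, c v < l + d) ∧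
      ∀ v ∈ {v | ∃ i : Fin m, i < k ∧ v ∈ A i}, ∀ w ∈ {v | ∃ i : Fin m, i < k ∧ v ∈ A i},
        H.Adj v w → c v ≠ c w := by
    intro k
    induction k with
    | zero => exact fun _ => ⟨fun _ => 0, by simp, by simp⟩
    | succ k ih =>
      intro hk
      have hunion : {v | ∃ i : Fin m, i < k + 1 ∧ v ∈ A i} =
          {v | ∃ i : Fin m, i < k ∧ v ∈ A i} ∪ A ⟨k, hk⟩ := by
        ext v
        constructor
        · rintro ⟨i, hi, hv⟩
          rcases Nat.lt_succ_iff_lt_or_eq.mp hi with h | h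
          · exact Or.inl ⟨i, h, hv⟩
          · obtain rfl : i = ⟨k, hk⟩ := Fin.ext h
            exact Or.inr hv
        · rintro (⟨i, hi, hv⟩ | hv)
          · exact ⟨i, Nat.lt_succ_of_lt hi, hv⟩
          · exact ⟨⟨k, hk⟩, Nat.lt_succ_self k, hv⟩
      rw [hunion]
      refine exists_coloring_union (hl ⟨k, hk⟩) (fun v _ hvB => ?_) (ih (Nat.le_of_succ_le hk))
      refine (Set.ncard_le_ncard ?_ (Set.toFinite _)).trans (hd v)
      rintro w ⟨hvw, i, hi, hw⟩
      exact ⟨hvw, i, fun hv => hvB ⟨i, hi, hv⟩, hw⟩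
  obtain ⟨c, hlt, hc⟩ := key m le_rfl
  have hmem : ∀ v, v ∈ {v | ∃ i : Fin m, i < m ∧ v ∈ A i} := fun v =>
    let ⟨i, hi⟩ := hcover v
    ⟨i, i.isLt, hi⟩
  exact ⟨SimpleGraph.Coloring.mk (fun v => (⟨c v, hlt v (hmem v)⟩ : Fin (l + d)))
    fun {v w} hvw h => hc v (hmem v) w (hmem w) hvw (Fin.mk.inj h)⟩
end

section
/- Let 𝒜 denote the family of 5-element subsets {v₁,…,v₅} of 𝔽_p² ∖ {0} whose elements are pairwise non-collinear and satisfy v₁+⋯+v₅ = 0, and let n = p² − 1. Then |𝒜|/n⁴ → 1/120 as the prime p tends to infinity; that is, for every ε > 0 there exists p₀ such that for all primes p ≥ p₀ one has | |𝒜|/n⁴ − 1/120 | ≤ ε. -/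
/-- Two vectors of `𝔽_p²` are collinear if one is a scalar multiple of the other. -/
def Coll (p : ℕ) (v w : Fin 2 → ZMod p) : Prop :=
  ∃ c : ZMod p, w = c • v ∨ v = c • w

/-- The family `𝒜` of 5-element subsets of `𝔽_p² ∖ {0}` whose elements are pairwise
non-collinear and sum to `0`. -/
def famA (p : ℕ) : Set (Finset (Fin 2 → ZMod p)) :=
  {S | S.card = 5 ∧ (∀ v ∈ S, v ≠ 0) ∧ (∑ v ∈ S, v) = 0 ∧
    ∀ v ∈ S, ∀ w ∈ S, v ≠ w → ¬ Coll p v w}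

/-- The bijections from `Fin 5` onto a fixed 5-element set `S`, seen as functions into the ambient
type, number `5! = 120`. -/
theorem card_filter_injective_image_eq {α : Type*} [Fintype α] [DecidableEq α] (S : Finset α)
    (hS : S.card = 5) :
    (Finset.univ.filter fun g : Fin 5 → α =>
      Function.Injective g ∧ Finset.univ.image g = S).card = 120 := by
  have e₀ : Fin 5 ≃ S := (finCongr hS.symm).trans S.equivFin.symm
  have h : Fintype.card (Fin 5 ≃ S) = 120 := by
    rw [Fintype.card_equiv e₀, Fintype.card_fin]
    rfl
  rw [← h, ← Finset.card_univ]
  symm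
  refine Finset.card_bij (fun (e : Fin 5 ≃ S) _ => fun i => (e i : α)) ?_ ?_ ?_
  · intro e _
    refine Finset.mem_filter.2
      ⟨Finset.mem_univ _, Subtype.val_injective.comp e.injective, ?_⟩
    ext x
    simp only [Finset.mem_image, Finset.mem_univ, true_and]
    constructor
    · rintro ⟨i, rfl⟩
      exact (e i).2
    · intro hx
      exact ⟨e.symm ⟨x, hx⟩, by simp⟩
  · intro e _ e' _ hee
    ext i
    exact congrFun hee i
  · intro g hg
    obtain ⟨-, hinj, him⟩ := Finset.mem_filter.1 hg
    have hmem : ∀ i, g i ∈ S := fun i => him ▸ Finset.mem_image_of_mem g (Finset.mem_univ i)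
    refine ⟨Equiv.ofBijective (fun i => (⟨g i, hmem i⟩ : S)) ⟨?_, ?_⟩, Finset.mem_univ _, rfl⟩
    · intro i j hij
      exact hinj (congrArg Subtype.val hij)
    · rintro ⟨x, hx⟩
      rw [← him] at hx
      obtain ⟨i, -, rfl⟩ := Finset.mem_image.1 hx
      exact ⟨i, rfl⟩

/-- The number of zero-sum 5-tuples in a finite additive group. -/
theorem card_filter_sum_eq_zero {α : Type*} [Fintype α] [DecidableEq α] [AddCommGroup α] :
    (Finset.univ.filter fun g : Fin 5 → α => ∑ i, g i = 0).card = Fintype.card α ^ 4 := by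
  have h : Fintype.card (Fin 4 → α) = Fintype.card α ^ 4 := by simp
  rw [← h, ← Finset.card_univ]
  symm
  refine Finset.card_bij (fun (f : Fin 4 → α) _ => Fin.cons (-∑ i, f i) f) ?_ ?_ ?_
  · intro f _
    refine Finset.mem_filter.2 ⟨Finset.mem_univ _, ?_⟩
    rw [Fin.sum_univ_succ]
    simp only [Fin.cons_zero, Fin.cons_succ, neg_add_cancel]
  · intro f _ f' _ hff
    exact (Fin.cons_injective2 hff).2
  · intro g hg
    refine ⟨Fin.tail g, Finset.mem_univ _, ?_⟩
    have hsum := (Finset.mem_filter.1 hg).2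
    rw [Fin.sum_univ_succ] at hsum
    have h0 : -∑ i, Fin.tail g i = g 0 := (eq_neg_of_add_eq_zero_left hsum).symm
    change Fin.cons (-∑ i, Fin.tail g i) (Fin.tail g) = g
    rw [h0, Fin.cons_self_tail]

/-- Few zero-sum 5-tuples have their `j`-th entry proportional to their `i`-th entry. -/
theorem card_filter_sum_eq_zero_smul_le {R M : Type*} [Ring R] [Fintype R] [AddCommGroup M]
    [Module R M] [Fintype M] [DecidableEq M] {i j : Fin 5} (hij : i ≠ j) :
    (Finset.univ.filter fun g : Fin 5 → M => ∑ k, g k = 0 ∧ ∃ c : R, g j = c • g i).card ≤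
      Fintype.card R * Fintype.card M ^ 3 := by
  classical
  obtain ⟨k, hki, hkj⟩ : ∃ k : Fin 5, k ≠ i ∧ k ≠ j := by
    revert i j
    decide
  have hcard : Fintype.card {x : Fin 5 // x ≠ j ∧ x ≠ k} = 3 := by
    revert hkj
    clear hki hij i
    revert j k
    decide
  have h : Fintype.card (R × ({x : Fin 5 // x ≠ j ∧ x ≠ k} → M)) =
      Fintype.card R * Fintype.card M ^ 3 := by
    rw [Fintype.card_prod, Fintype.card_fun, hcard]
  rw [← h, ← Finset.card_univ]
  choose! c hc using fun (g : Fin 5 → M) (hg : ∃ c : R, g j = c • g i) => hg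
  refine Finset.card_le_card_of_injOn (fun g => (c g, fun x => g x.1))
    (fun _ _ => Finset.mem_coe.2 (Finset.mem_univ _)) ?_
  intro g hg g' hg' hgg
  obtain ⟨hs, hp⟩ := (Finset.mem_filter.1 (Finset.mem_coe.1 hg)).2
  obtain ⟨hs', hp'⟩ := (Finset.mem_filter.1 (Finset.mem_coe.1 hg')).2
  obtain ⟨hcc, hr⟩ := Prod.mk.inj hgg
  have hrest : ∀ x, x ≠ j → x ≠ k → g x = g' x := fun x hx hx' => congrFun hr ⟨x, hx, hx'⟩
  have hj : g j = g' j := by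
    rw [hc g hp, hc g' hp', hcc, hrest i hij hki.symm]
  have hne : ∀ x, x ≠ k → g x = g' x := by
    intro x hx
    by_cases hxj : x = j
    · rw [hxj, hj]
    · exact hrest x hxj hx
  have hk : g k = g' k := by
    rw [← Finset.add_sum_erase _ _ (Finset.mem_univ k)] at hs hs'
    rw [Finset.sum_congr rfl fun x hx => hne x (Finset.ne_of_mem_erase hx)] at hs
    exact add_right_cancel (hs.trans hs'.symm)
  funext x
  by_cases hx : x = k
  · rw [hx, hk]
  · exact hne x hx

open Classical in
/-- The ordered version of `famA`. -/
noncomputable def tupA (p : ℕ) [NeZero p] : Finset (Fin 5 → Fin 2 → ZMod p) :=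
  Finset.univ.filter fun g => ∑ i, g i = 0 ∧ ∀ i j, i ≠ j → ¬ Coll p (g i) (g j)

theorem Coll.refl {p : ℕ} (v : Fin 2 → ZMod p) : Coll p v v := ⟨1, Or.inl (one_smul _ v).symm⟩

theorem Coll.zero_left {p : ℕ} (v : Fin 2 → ZMod p) : Coll p 0 v :=
  ⟨0, Or.inr (zero_smul _ v).symm⟩

theorem mem_tupA_iff {p : ℕ} [NeZero p] {g : Fin 5 → Fin 2 → ZMod p} :
    g ∈ tupA p ↔ Function.Injective g ∧ Finset.univ.image g ∈ famA p := by
  simp only [tupA, Finset.mem_filter, Finset.mem_univ, true_and]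
  constructor
  · rintro ⟨hsum, hcoll⟩
    have hinj : Function.Injective g := by
      intro i j hij
      by_contra hne
      exact hcoll i j hne (hij ▸ Coll.refl _)
    refine ⟨hinj, ?_, ?_, ?_, ?_⟩
    · rw [Finset.card_image_of_injective _ hinj]
      simp
    · intro v hv hv0
      obtain ⟨i, -, rfl⟩ := Finset.mem_image.1 hv
      exact hcoll i (i + 1) (by clear hv hv0; revert i; decide) (hv0 ▸ Coll.zero_left _)
    · rw [Finset.sum_image fun i _ j _ hij => hinj hij]
      exact hsum
    · intro v hv w hw hvw
      obtain ⟨i, -, rfl⟩ := Finset.mem_image.1 hv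
      obtain ⟨j, -, rfl⟩ := Finset.mem_image.1 hw
      exact hcoll i j fun h => hvw (h ▸ rfl)
  · rintro ⟨hinj, -, -, hsum, hcoll⟩
    rw [Finset.sum_image fun i _ j _ hij => hinj hij] at hsum
    exact ⟨hsum, fun i j hij => hcoll _ (Finset.mem_image_of_mem g (Finset.mem_univ i)) _
      (Finset.mem_image_of_mem g (Finset.mem_univ j)) (hinj.ne hij)⟩

theorem card_tupA (p : ℕ) [NeZero p] : (tupA p).card = 120 * (famA p).ncard := by
  classical
  rw [Set.ncard_eq_toFinset_card', mul_comm]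
  refine (Finset.card_eq_sum_card_fiberwise (f := fun g => Finset.univ.image g)
    (t := (famA p).toFinset) ?_).trans ?_
  · intro g hg
    simpa using (mem_tupA_iff.1 hg).2
  · refine Finset.sum_const_nat fun S hS => ?_
    rw [Set.mem_toFinset] at hS
    rw [← card_filter_injective_image_eq S hS.1]
    congr 1
    ext g
    simp only [Finset.mem_filter, Finset.mem_univ, true_and, mem_tupA_iff]
    constructor
    · rintro ⟨⟨h, -⟩, h'⟩
      exact ⟨h, h'⟩
    · rintro ⟨h, h'⟩
      exact ⟨⟨h, h'.symm ▸ hS⟩, h'⟩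

theorem card_tupA_le (p : ℕ) [NeZero p] : (tupA p).card ≤ p ^ 8 := by
  classical
  calc (tupA p).card
      ≤ (Finset.univ.filter fun g : Fin 5 → Fin 2 → ZMod p => ∑ i, g i = 0).card := by
        refine Finset.card_le_card fun g hg => ?_
        simp only [tupA, Finset.mem_filter, Finset.mem_univ, true_and] at hg ⊢
        exact hg.1
    _ = p ^ 8 := by
        rw [card_filter_sum_eq_zero, Fintype.card_fun, ZMod.card, Fintype.card_fin, ← pow_mul]

theorem le_card_tupA_add (p : ℕ) [NeZero p] : p ^ 8 ≤ (tupA p).card + 20 * p ^ 7 := by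
  classical
  let B : Fin 5 × Fin 5 → Finset (Fin 5 → Fin 2 → ZMod p) := fun x =>
    Finset.univ.filter fun g => ∑ k, g k = 0 ∧ ∃ c : ZMod p, g x.2 = c • g x.1
  have hsub : (Finset.univ.filter fun g : Fin 5 → Fin 2 → ZMod p => ∑ i, g i = 0) ⊆
      tupA p ∪ (Finset.univ : Finset (Fin 5)).offDiag.biUnion B := by
    intro g hg
    replace hg := (Finset.mem_filter.1 hg).2
    by_cases hc : ∀ i j, i ≠ j → ¬ Coll p (g i) (g j)
    · exact Finset.mem_union_left _ (Finset.mem_filter.2 ⟨Finset.mem_univ _, hg, hc⟩)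
    · push Not at hc
      obtain ⟨i, j, hij, c, h | h⟩ := hc
      · exact Finset.mem_union_right _ (Finset.mem_biUnion.2 ⟨(i, j), by simpa using hij,
          Finset.mem_filter.2 ⟨Finset.mem_univ _, hg, c, h⟩⟩)
      · exact Finset.mem_union_right _ (Finset.mem_biUnion.2 ⟨(j, i), by simpa using hij.symm,
          Finset.mem_filter.2 ⟨Finset.mem_univ _, hg, c, h⟩⟩)
  have hB : ∀ x ∈ (Finset.univ : Finset (Fin 5)).offDiag, (B x).card ≤ p ^ 7 := by
    intro x hx
    refine (card_filter_sum_eq_zero_smul_le (Finset.mem_offDiag.1 hx).2.2).trans_eq ?_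
    rw [Fintype.card_fun, ZMod.card, Fintype.card_fin]
    ring
  calc p ^ 8
      = (Finset.univ.filter fun g : Fin 5 → Fin 2 → ZMod p => ∑ i, g i = 0).card := by
        rw [card_filter_sum_eq_zero, Fintype.card_fun, ZMod.card, Fintype.card_fin, ← pow_mul]
    _ ≤ (tupA p).card + ((Finset.univ : Finset (Fin 5)).offDiag.biUnion B).card :=
        (Finset.card_le_card hsub).trans (Finset.card_union_le _ _)
    _ ≤ (tupA p).card + 20 * p ^ 7 :=
        Nat.add_le_add_left (Finset.card_biUnion_le_card_mul _ _ _ hB) _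

theorem abs_div_sub_one_div_le {a x : ℝ} (hx : 2 ≤ x) (hle : 120 * a ≤ x ^ 8)
    (hge : x ^ 8 ≤ 120 * a + 20 * x ^ 7) : |a / (x ^ 2 - 1) ^ 4 - 1 / 120| ≤ 4 / x := by
  have hx0 : 0 < x := by linarith
  have hn : x ^ 2 / 2 ≤ x ^ 2 - 1 := by nlinarith
  have hn0 : 0 < x ^ 2 - 1 := by nlinarith
  have hn4 : x ^ 8 / 16 ≤ (x ^ 2 - 1) ^ 4 := by
    calc x ^ 8 / 16 = (x ^ 2 / 2) ^ 4 := by ring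
      _ ≤ _ := by gcongr
  have hn4' : (x ^ 2 - 1) ^ 4 ≤ x ^ 8 := by
    calc (x ^ 2 - 1) ^ 4 ≤ (x ^ 2) ^ 4 := by gcongr; linarith
      _ = x ^ 8 := by ring
  have hbern : x ^ 8 - 4 * x ^ 6 ≤ (x ^ 2 - 1) ^ 4 := by
    nlinarith [sq_nonneg (x ^ 2 - 1), sq_nonneg x]
  have h67 : x ^ 6 ≤ x ^ 7 := pow_le_pow_right₀ (by linarith) (by norm_num)
  have hpos : 0 < (x ^ 2 - 1) ^ 4 := by positivity
  have key : |120 * a - (x ^ 2 - 1) ^ 4| ≤ 20 * x ^ 7 := by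
    rw [abs_le]
    have h27 : 2 * x ^ 6 ≤ x ^ 7 := by
      calc 2 * x ^ 6 ≤ x * x ^ 6 := by gcongr
        _ = x ^ 7 := by ring
    constructor <;> nlinarith [pow_pos hx0 7]
  have heq : a / (x ^ 2 - 1) ^ 4 - 1 / 120 =
      (120 * a - (x ^ 2 - 1) ^ 4) / (120 * (x ^ 2 - 1) ^ 4) := by
    field_simp
  rw [heq, abs_div, abs_of_pos (by positivity : 0 < 120 * (x ^ 2 - 1) ^ 4),
    div_le_div_iff₀ (by positivity) hx0]
  calc |120 * a - (x ^ 2 - 1) ^ 4| * x ≤ 20 * x ^ 7 * x := by gcongr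
    _ = 20 * x ^ 8 := by ring
    _ ≤ 4 * (120 * (x ^ 2 - 1) ^ 4) := by linarith [pow_pos hx0 8]

/-- `|𝒜| / n⁴ → 1/120` as the prime `p` tends to infinity, where `n = p² - 1`. -/
theorem stmt7 (ε : ℝ) (hε : 0 < ε) :
    ∃ p₀ : ℕ, ∀ p : ℕ, p₀ ≤ p → p.Prime →
      |((famA p).ncard : ℝ) / ((p ^ 2 - 1 : ℕ) : ℝ) ^ 4 - 1 / 120| ≤ ε := by
  obtain ⟨N, hN⟩ := exists_nat_gt (4 / ε)
  refine ⟨N, fun p hp hprime => ?_⟩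
  have : NeZero p := ⟨hprime.ne_zero⟩
  have h2 : (2 : ℝ) ≤ p := by exact_mod_cast hprime.two_le
  have hle : 120 * ((famA p).ncard : ℝ) ≤ (p : ℝ) ^ 8 := by
    exact_mod_cast card_tupA p ▸ card_tupA_le p
  have hge : (p : ℝ) ^ 8 ≤ 120 * ((famA p).ncard : ℝ) + 20 * (p : ℝ) ^ 7 := by
    exact_mod_cast card_tupA p ▸ le_card_tupA_add p
  have hcast : ((p ^ 2 - 1 : ℕ) : ℝ) = (p : ℝ) ^ 2 - 1 := by
    rw [Nat.cast_sub (Nat.one_le_pow _ _ hprime.pos)]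
    push_cast
    rfl
  rw [hcast]
  refine (abs_div_sub_one_div_le h2 hle hge).trans ?_
  have hNp : (N : ℝ) ≤ p := by exact_mod_cast hp
  rw [div_le_iff₀ (by linarith)]
  rw [div_lt_iff₀ hε] at hN
  nlinarith
end

section
/- Let p be a prime and let A be a 5-element subset of 𝔽_p² ∖ {0} whose elements are pairwise non-collinear. Then the number of g ∈ GL₂(𝔽_p) with g ≠ 1 such that |A ∩ g·A| ≥ 2 is at most 380 (= 20·19), where g·A = {g·v : v ∈ A}. -/
theorem Coll.of_det_eq_zero {p : ℕ} [Fact p.Prime] {v w : Fin 2 → ZMod p}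
    (h : v 0 * w 1 - v 1 * w 0 = 0) : Coll p v w := by
  by_cases hv0 : v 0 = 0
  · by_cases hv1 : v 1 = 0
    · refine ⟨0, Or.inr ?_⟩
      ext i
      fin_cases i <;> simp [hv0, hv1]
    · refine ⟨w 1 / v 1, Or.inl ?_⟩
      ext i
      fin_cases i
      · simp_all
      · simp [hv1]
  · refine ⟨w 0 / v 0, Or.inl ?_⟩
    ext i
    fin_cases i
    · simp [hv0]
    · simp only [Fin.mk_one, Pi.smul_apply, smul_eq_mul]
      field_simp
      linear_combination h

/-- A `2 × 2` matrix is determined by its values on two non-collinear vectors. -/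
theorem Matrix.eq_of_mulVec_eq_of_not_coll {p : ℕ} [Fact p.Prime]
    {M N : Matrix (Fin 2) (Fin 2) (ZMod p)} {v w : Fin 2 → ZMod p} (h : ¬ Coll p v w)
    (hv : M.mulVec v = N.mulVec v) (hw : M.mulVec w = N.mulVec w) : M = N := by
  have hdet : v 0 * w 1 - v 1 * w 0 ≠ 0 := fun h' => h (Coll.of_det_eq_zero h')
  ext i j
  have hvi := congrFun hv i
  have hwi := congrFun hw i
  simp only [Matrix.mulVec, dotProduct, Fin.sum_univ_two] at hvi hwi
  apply mul_right_cancel₀ hdet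
  fin_cases j
  · simp only [Fin.zero_eta]
    linear_combination w 1 * hvi - v 1 * hwi
  · simp only [Fin.mk_one]
    linear_combination v 0 * hwi - w 0 * hvi

/-- Let `A` be a 5-element subset of `𝔽_p² ∖ {0}` whose elements are pairwise non-collinear.
Then the number of `g ∈ GL₂(𝔽_p)`, `g ≠ 1`, with `|A ∩ g·A| ≥ 2` is at most `380 = 20·19`. -/
theorem stmt8 (p : ℕ) (hp : p.Prime) (A : Finset (Fin 2 → ZMod p)) (hA : A.card = 5)
    (h0 : ∀ v ∈ A, v ≠ 0) (hcoll : ∀ v ∈ A, ∀ w ∈ A, v ≠ w → ¬ Coll p v w) :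
    ({g : GL (Fin 2) (ZMod p) | g ≠ 1 ∧
      2 ≤ (A ∩ A.image (fun v => (g : Matrix (Fin 2) (Fin 2) (ZMod p)).mulVec v)).card}).ncard
      ≤ 380 := by
  have : Fact p.Prime := ⟨hp⟩
  have key : ∀ g ∈ {g : GL (Fin 2) (ZMod p) | g ≠ 1 ∧
      2 ≤ (A ∩ A.image (fun v => (g : Matrix (Fin 2) (Fin 2) (ZMod p)).mulVec v)).card},
      ∃ q ∈ A.offDiag.offDiag, (g : Matrix (Fin 2) (Fin 2) (ZMod p)).mulVec q.1.1 = q.2.1 ∧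
        (g : Matrix (Fin 2) (Fin 2) (ZMod p)).mulVec q.1.2 = q.2.2 := by
    rintro g ⟨hg, hcard⟩
    obtain ⟨c, hc, d, hd, hcd⟩ := Finset.one_lt_card.mp hcard
    simp only [Finset.mem_inter, Finset.mem_image] at hc hd
    obtain ⟨hcA, a, ha, rfl⟩ := hc
    obtain ⟨hdA, b, hb, rfl⟩ := hd
    have hab : a ≠ b := fun h => hcd (by rw [h])
    refine ⟨((a, b), ((g : Matrix (Fin 2) (Fin 2) (ZMod p)).mulVec a,
      (g : Matrix (Fin 2) (Fin 2) (ZMod p)).mulVec b)), ?_, rfl, rfl⟩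
    simp only [Finset.mem_offDiag]
    refine ⟨⟨ha, hb, hab⟩, ⟨hcA, hdA, hcd⟩, fun h => hg ?_⟩
    rw [Prod.mk.injEq] at h
    apply Units.ext
    apply Matrix.eq_of_mulVec_eq_of_not_coll (hcoll a ha b hb hab)
    · simpa using h.1.symm
    · simpa using h.2.symm
  choose! f hfmem hf₁ hf₂ using key
  have hcard : A.offDiag.offDiag.card = 380 := by
    simp [Finset.offDiag_card, hA]
  rw [← hcard, ← Set.ncard_coe_finset]
  refine Set.ncard_le_ncard_of_injOn f hfmem ?_ (Finset.finite_toSet _)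
  intro g hg g' hg' hgg'
  have hmem := (Finset.mem_offDiag.mp (hfmem g hg)).1
  rw [Finset.mem_offDiag] at hmem
  apply Units.ext
  apply Matrix.eq_of_mulVec_eq_of_not_coll (hcoll _ hmem.1 _ hmem.2.1 hmem.2.2)
  · rw [hf₁ g hg, hgg', hf₁ g' hg']
  · rw [hf₂ g hg, hgg', hf₂ g' hg']
end

section
/- There exists p₀ such that for every prime p ≥ p₀ the following holds (with n = p² − 1): if ω = (d_{ij})_{1≤i≠j≤5} is a trivial dependence of length at most n^{0.01}, then d_{ij} + d_{ji} = 0 for all i ≠ j, and the sum D = ∑_{i<j} d_{ij} is even. -/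
/-- `gmat p a b` is the 2×2 matrix over `𝔽_p` whose columns are `a` and `b`. -/
def gmat (p : ℕ) (a b : Fin 2 → ZMod p) : Matrix (Fin 2) (Fin 2) (ZMod p) :=
  Matrix.of fun i j => if j = 0 then a i else b i

/-- The set of off-diagonal index pairs `(i,j)`, `i ≠ j`, of `Fin 5`. -/
def offDiag5 : Finset (Fin 5 × Fin 5) :=
  Finset.univ.filter fun ij => ij.1 ≠ ij.2

/-- The set of index pairs `(i,j)` with `i < j` in `Fin 5`. -/
def underDiag5 : Finset (Fin 5 × Fin 5) :=
  Finset.univ.filter fun ij => ij.1 < ij.2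

/-- `𝒜_ord`: the set of 5-tuples of pairwise non-collinear vectors of `𝔽_p² ∖ {0}`
summing to `0`. -/
def AOrd (p : ℕ) : Set (Fin 5 → Fin 2 → ZMod p) :=
  {A | (∀ i, A i ≠ 0) ∧ (∑ i, A i) = 0 ∧ ∀ i j, i ≠ j → ¬ Coll p (A i) (A j)}

/-- A tuple of integers `(d_{ij})_{i≠j}` is a dependence if `∑_{i≠j} d_{ij} = 0`. -/
def IsDep (d : Fin 5 → Fin 5 → ℤ) : Prop :=
  ∑ ij ∈ offDiag5, d ij.1 ij.2 = 0

/-- Twice the length of a dependence: `∑_{i<j} |d_{ij} + d_{ji}|`. -/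
def depLen2 (d : Fin 5 → Fin 5 → ℤ) : ℤ :=
  ∑ ij ∈ underDiag5, |d ij.1 ij.2 + d ij.2 ij.1|

/-- The value `ω(A) = ∏_{i≠j} det(g_{ij}(A))^{d_{ij}}` of a dependence at a tuple `A`. -/
def omegaEval (p : ℕ) [Fact p.Prime] (d : Fin 5 → Fin 5 → ℤ)
    (A : Fin 5 → Fin 2 → ZMod p) : ZMod p :=
  ∏ ij ∈ offDiag5, (gmat p (A ij.1) (A ij.2)).det ^ (d ij.1 ij.2)

/-- A dependence is trivial if `ω(A) = 1` for all `A ∈ 𝒜_ord`. -/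
def TrivialDep (p : ℕ) [Fact p.Prime] (d : Fin 5 → Fin 5 → ℤ) : Prop :=
  ∀ A ∈ AOrd p, omegaEval p d A = 1

open Polynomial in
/-- If a product of integer powers of affine functions with pairwise distinct roots is a nonzero
constant off those roots, and the exponents are small compared to the size of the field, then all
the exponents vanish. -/
theorem exponents_eq_zero_of_prod_affine_zpow_const {F ι : Type*} [Field F] [Fintype F]
    (s : Finset ι) (a b : ι → F) (hb : ∀ k ∈ s, b k ≠ 0)
    (hab : ∀ k ∈ s, ∀ l ∈ s, k ≠ l → a l * b k - b l * a k ≠ 0) (e : ι → ℤ) (c : F) (hc : c ≠ 0)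
    (hcard : (∑ k ∈ s, |e k|) + s.card < Fintype.card F)
    (h : ∀ t, (∀ k ∈ s, a k + b k * t ≠ 0) → ∏ k ∈ s, (a k + b k * t) ^ e k = c) :
    ∀ k ∈ s, e k = 0 := by
  classical
  set L : ι → F[X] := fun k => C (a k) + C (b k) * X with hL
  have evalL : ∀ k t, (L k).eval t = a k + b k * t := by simp [hL]
  have degL : ∀ k, (L k).natDegree ≤ 1 := fun k => by
    rw [hL]; dsimp only; rw [add_comm]; exact natDegree_linear_le
  have degProd : ∀ m : ι → ℕ, (∏ k ∈ s, L k ^ m k).natDegree ≤ ∑ k ∈ s, m k := fun m =>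
    (natDegree_prod_le _ _).trans <| Finset.sum_le_sum fun k _ =>
      natDegree_pow_le.trans (by simpa using Nat.mul_le_mul_left (m k) (degL k))
  set P : F[X] := ∏ k ∈ s, L k ^ (e k).toNat with hP
  set Q : F[X] := ∏ k ∈ s, L k ^ (-e k).toNat with hQ
  set N : F[X] := ∏ k ∈ s, L k with hN
  have hN0 : N ≠ 0 := Finset.prod_ne_zero_iff.2 fun k hk h0 => hb k hk <| by
    simpa [hL] using congrArg (fun q => q.coeff 1) h0
  have degP : P.natDegree ≤ ∑ k ∈ s, (e k).natAbs :=
    (degProd _).trans (Finset.sum_le_sum fun k _ => by omega)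
  have degQ : Q.natDegree ≤ ∑ k ∈ s, (e k).natAbs :=
    (degProd _).trans (Finset.sum_le_sum fun k _ => by omega)
  have degN : N.natDegree ≤ s.card := by simpa using degProd fun _ => 1
  have hcard' : (∑ k ∈ s, (e k).natAbs) + s.card < Fintype.card F := by
    zify; simpa using hcard
  have hPQ : P = C c * Q := by
    have hzero : (P - C c * Q) * N = 0 := by
      refine eq_zero_of_natDegree_lt_card_of_eval_eq_zero _ Function.injective_id (fun t => ?_) ?_
      · by_cases ht : ∀ k ∈ s, a k + b k * t ≠ 0
        · have hprod := h t ht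
          have hsplit : P.eval t = c * Q.eval t := by
            rw [← hprod, hP, hQ, eval_prod, eval_prod, ← Finset.prod_mul_distrib]
            refine Finset.prod_congr rfl fun k hk => ?_
            rw [eval_pow, eval_pow, evalL, ← zpow_natCast, ← zpow_natCast, ← zpow_add₀ (ht k hk)]
            congr 1
            omega
          simp [hsplit]
        · push Not at ht
          obtain ⟨k, hk, h0⟩ := ht
          have : N.eval t = 0 := by
            rw [hN, eval_prod]
            exact Finset.prod_eq_zero hk (by rw [evalL, h0])
          simp [this]
      · refine lt_of_le_of_lt (natDegree_mul_le.trans (add_le_add ?_ degN)) hcard'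
        exact (natDegree_sub_le_of_le degP ((natDegree_C_mul_le _ _).trans degQ)).trans_eq (max_self _)
    exact sub_eq_zero.1 ((mul_eq_zero.1 hzero).resolve_right hN0)
  intro k hk
  have root_iff : ∀ m : ι → ℕ, (∏ l ∈ s, L l ^ m l).eval (-a k / b k) = 0 ↔ m k ≠ 0 := by
    intro m
    have hbk := hb k hk
    rw [eval_prod, Finset.prod_eq_zero_iff]
    constructor
    · rintro ⟨l, hl, h0⟩ hm
      rcases eq_or_ne k l with rfl | hkl
      · simp [hm] at h0
      · rw [eval_pow, evalL] at h0
        have h1 := eq_zero_of_pow_eq_zero h0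
        apply hab k hk l hl hkl
        field_simp at h1
        linear_combination h1
    · intro hm
      refine ⟨k, hk, ?_⟩
      rw [eval_pow, evalL, mul_div_cancel₀ _ hbk, add_neg_cancel, zero_pow hm]
  have key := congrArg (fun q => q.eval (-a k / b k) = 0) hPQ
  simp only [eval_mul, eval_C, mul_eq_zero, hc, false_or, hP, hQ, root_iff, eq_iff_iff] at key
  omega

/-- The integer points through which the lines of the test family pass. -/
def basePoint : Fin 5 → Fin 2 → ℤ :=
  ![![1, -1], ![1, 0], ![1, 1], ![1, 2], ![-4, -2]]

/-- The vertical speeds of the test family. -/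
def speed : Fin 5 → ℤ := ![2, 5, 4, 6, -17]

/-- The constant coefficient of the determinants of the test family. -/
def detConst (k : Fin 5 × Fin 5) : ℤ :=
  basePoint k.1 0 * basePoint k.2 1 - basePoint k.2 0 * basePoint k.1 1

/-- The linear coefficient of the determinants of the test family. -/
def detSlope (k : Fin 5 × Fin 5) : ℤ :=
  basePoint k.1 0 * speed k.2 - basePoint k.2 0 * speed k.1

/-- A one-parameter family of 5-tuples with sum zero, whose determinants are affine in `t`. -/
def testTuple (p : ℕ) (t : ZMod p) (i : Fin 5) : Fin 2 → ZMod p :=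
  ![(basePoint i 0 : ZMod p), (basePoint i 1 : ZMod p) + speed i * t]

theorem detConst_bounds : ∀ k ∈ underDiag5, detConst k ≠ 0 ∧ |detConst k| < 100 := by
  decide

theorem detSlope_bounds : ∀ k ∈ underDiag5, detSlope k ≠ 0 ∧ |detSlope k| < 100 := by
  decide

theorem detResultant_bounds : ∀ k ∈ underDiag5, ∀ l ∈ underDiag5, k ≠ l →
    detConst l * detSlope k - detSlope l * detConst k ≠ 0 ∧
      |detConst l * detSlope k - detSlope l * detConst k| < 100 := by
  decide

theorem ZMod.intCast_ne_zero_of_abs_lt {p : ℕ} {z : ℤ} (hz : z ≠ 0) (hzp : |z| < p) :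
    (z : ZMod p) ≠ 0 := fun h =>
  hz (Int.eq_zero_of_abs_lt_dvd ((ZMod.intCast_zmod_eq_zero_iff_dvd z p).1 h) hzp)

theorem det_gmat (p : ℕ) (v w : Fin 2 → ZMod p) :
    (gmat p v w).det = v 0 * w 1 - w 0 * v 1 := by
  simp [gmat, Matrix.det_fin_two]

theorem det_gmat_swap (p : ℕ) (v w : Fin 2 → ZMod p) :
    (gmat p w v).det = -(gmat p v w).det := by
  rw [det_gmat, det_gmat]
  ring

theorem det_gmat_eq_zero_of_coll {p : ℕ} {v w : Fin 2 → ZMod p} (h : Coll p v w) :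
    (gmat p v w).det = 0 := by
  rw [det_gmat]
  obtain ⟨c, rfl | rfl⟩ := h <;> simp <;> ring

theorem det_gmat_testTuple (p : ℕ) (t : ZMod p) (k : Fin 5 × Fin 5) :
    (gmat p (testTuple p t k.1) (testTuple p t k.2)).det = detConst k + detSlope k * t := by
  simp [det_gmat, testTuple, detConst, detSlope]
  ring

theorem sum_testTuple (p : ℕ) (t : ZMod p) : ∑ i, testTuple p t i = 0 := by
  ext j
  fin_cases j <;> simp [Fin.sum_univ_five, testTuple, basePoint, speed] <;> ring

theorem mem_AOrd_of_det_ne_zero {p : ℕ} {A : Fin 5 → Fin 2 → ZMod p} (hsum : ∑ i, A i = 0)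
    (h : ∀ k ∈ underDiag5, (gmat p (A k.1) (A k.2)).det ≠ 0) : A ∈ AOrd p := by
  have hcoll : ∀ i j, i ≠ j → ¬ Coll p (A i) (A j) := by
    intro i j hij hc
    rcases lt_or_gt_of_ne hij with hlt | hlt
    · exact h (i, j) (by simpa [underDiag5] using hlt) (det_gmat_eq_zero_of_coll hc)
    · refine h (j, i) (by simpa [underDiag5] using hlt) ?_
      rw [det_gmat_swap, det_gmat_eq_zero_of_coll hc, neg_zero]
  refine ⟨fun i hi => ?_, hsum, hcoll⟩
  exact hcoll i (i + 1) (by clear hi; revert i; decide) ⟨0, Or.inr (by simpa using hi)⟩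

theorem prod_offDiag5_eq {M : Type*} [CommMonoid M] (f : Fin 5 × Fin 5 → M) :
    ∏ k ∈ offDiag5, f k = ∏ k ∈ underDiag5, f k * f k.swap := by
  have hunion : offDiag5 = underDiag5 ∪ underDiag5.image Prod.swap := by decide
  have hdisj : Disjoint underDiag5 (underDiag5.image Prod.swap) := by decide
  rw [hunion, Finset.prod_union hdisj, Finset.prod_image (Prod.swap_injective.injOn),
    Finset.prod_mul_distrib]

theorem omegaEval_eq {p : ℕ} [Fact p.Prime] (d : Fin 5 → Fin 5 → ℤ)
    {A : Fin 5 → Fin 2 → ZMod p}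
    (h : ∀ k ∈ underDiag5, (gmat p (A k.1) (A k.2)).det ≠ 0) :
    omegaEval p d A = (-1) ^ (∑ k ∈ underDiag5, d k.2 k.1) *
      ∏ k ∈ underDiag5, (gmat p (A k.1) (A k.2)).det ^ (d k.1 k.2 + d k.2 k.1) := by
  have hneg : ((-1 : ZMod p)) ^ (∑ k ∈ underDiag5, d k.2 k.1) =
      ∏ k ∈ underDiag5, (-1 : ZMod p) ^ d k.2 k.1 := by
    generalize underDiag5 = s
    induction s using Finset.cons_induction with
    | empty => simp
    | cons k s hk ih =>
      rw [Finset.sum_cons, Finset.prod_cons, zpow_add₀ (neg_ne_zero.2 one_ne_zero), ih]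
  rw [omegaEval, prod_offDiag5_eq, hneg, ← Finset.prod_mul_distrib]
  refine Finset.prod_congr rfl fun k hk => ?_
  rw [Prod.fst_swap, Prod.snd_swap, det_gmat_swap p (A k.1), neg_eq_neg_one_mul, mul_zpow,
    zpow_add₀ (h k hk)]
  ring

theorem length_bound_lt {p : ℕ} (hp : 100 ≤ p) :
    2 * ((p ^ 2 - 1 : ℕ) : ℝ) ^ (0.01 : ℝ) + 10 < p := by
  have hp' : (100 : ℝ) ≤ p := by exact_mod_cast hp
  have hle : ((p ^ 2 - 1 : ℕ) : ℝ) ≤ (p : ℝ) ^ (2 : ℝ) := by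
    rw [Real.rpow_two]
    exact_mod_cast Nat.sub_le _ _
  have hsqrt : ((p ^ 2 - 1 : ℕ) : ℝ) ^ (0.01 : ℝ) ≤ √(p : ℝ) := by
    rw [Real.sqrt_eq_rpow]
    calc ((p ^ 2 - 1 : ℕ) : ℝ) ^ (0.01 : ℝ)
        ≤ ((p : ℝ) ^ (2 : ℝ)) ^ (0.01 : ℝ) :=
          Real.rpow_le_rpow (Nat.cast_nonneg _) hle (by norm_num)
      _ = (p : ℝ) ^ ((2 : ℝ) * 0.01) := (Real.rpow_mul (by positivity) _ _).symm
      _ ≤ (p : ℝ) ^ (1 / 2 : ℝ) := Real.rpow_le_rpow_of_exponent_le (by linarith) (by norm_num)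
  have h10 : (10 : ℝ) ≤ √(p : ℝ) := Real.le_sqrt_of_sq_le (by linarith)
  nlinarith [Real.sq_sqrt (show (0 : ℝ) ≤ p by linarith)]

/-- There exists `p₀` such that for every prime `p ≥ p₀` (with `n = p² - 1`): every trivial
dependence `(d_{ij})` of length at most `n^{0.01}` satisfies `d_{ij} + d_{ji} = 0` for all
`i ≠ j`, and `D = ∑_{i<j} d_{ij}` is even. -/
theorem stmt10 :
    ∃ p₀ : ℕ, ∀ (p : ℕ) [Fact p.Prime], p₀ ≤ p →
      ∀ d : Fin 5 → Fin 5 → ℤ, IsDep d →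
        (depLen2 d : ℝ) ≤ 2 * ((p ^ 2 - 1 : ℕ) : ℝ) ^ (0.01 : ℝ) →
        TrivialDep p d →
        (∀ i j : Fin 5, i ≠ j → d i j + d j i = 0) ∧
          Even (∑ ij ∈ underDiag5, d ij.1 ij.2) := by
  refine ⟨100, fun p _ hp d _ hlen htriv => ?_⟩
  have lift_ne : ∀ {z : ℤ}, z ≠ 0 ∧ |z| < 100 → (z : ZMod p) ≠ 0 := fun hz =>
    ZMod.intCast_ne_zero_of_abs_lt hz.1 (by omega)
  set c : ZMod p := (-1) ^ (∑ k ∈ underDiag5, d k.2 k.1) with hc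
  have hc0 : c ≠ 0 := zpow_ne_zero _ (neg_ne_zero.2 one_ne_zero)
  have hconst : ∀ t : ZMod p, (∀ k ∈ underDiag5, (detConst k : ZMod p) + detSlope k * t ≠ 0) →
      c * ∏ k ∈ underDiag5, ((detConst k : ZMod p) + detSlope k * t) ^ (d k.1 k.2 + d k.2 k.1)
        = 1 := by
    intro t ht
    simp only [← det_gmat_testTuple] at ht ⊢
    rw [hc, ← omegaEval_eq d ht]
    exact htriv _ (mem_AOrd_of_det_ne_zero (sum_testTuple p t) ht)
  have hcard : (∑ k ∈ underDiag5, |d k.1 k.2 + d k.2 k.1|) + (underDiag5.card : ℤ)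
      < Fintype.card (ZMod p) := by
    have hten : underDiag5.card = 10 := by decide
    rw [hten, ZMod.card]
    have hlt : ((depLen2 d + 10 : ℤ) : ℝ) < ((p : ℤ) : ℝ) := by
      push_cast
      linarith [length_bound_lt hp]
    exact_mod_cast hlt
  have hzero := exponents_eq_zero_of_prod_affine_zpow_const underDiag5
    (fun k => (detConst k : ZMod p)) (fun k => (detSlope k : ZMod p))
    (fun k hk => lift_ne (detSlope_bounds k hk))
    (fun k hk l hl hkl => by exact_mod_cast lift_ne (detResultant_bounds k hk l hl hkl))
    (fun k => d k.1 k.2 + d k.2 k.1) c⁻¹ (inv_ne_zero hc0) hcard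
    (fun t ht => eq_inv_of_mul_eq_one_right (hconst t ht))
  refine ⟨fun i j hij => ?_, ?_⟩
  · rcases lt_or_gt_of_ne hij with hlt | hlt
    · exact hzero (i, j) (by simpa [underDiag5] using hlt)
    · rw [add_comm]
      exact hzero (j, i) (by simpa [underDiag5] using hlt)
  · have hc1 : c = 1 := by
      have := hconst 0 fun k hk => by simpa using lift_ne (detConst_bounds k hk)
      rwa [Finset.prod_congr rfl fun k hk => by rw [hzero k hk, zpow_zero],
        Finset.prod_const_one, mul_one] at this
    have hsum : ∑ k ∈ underDiag5, d k.1 k.2 = -∑ k ∈ underDiag5, d k.2 k.1 := by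
      rw [eq_neg_iff_add_eq_zero, ← Finset.sum_add_distrib]
      exact Finset.sum_eq_zero hzero
    rw [hsum, even_neg]
    by_contra hodd
    rw [Int.not_even_iff_odd] at hodd
    have : Fact (2 < p) := ⟨by omega⟩
    exact ZMod.neg_one_ne_one (hodd.neg_one_zpow.symm.trans hc1)
end
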